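/- Lemma: Let P be a rook placement on a rectangular Ferrers board F with no square of P in column a, let b > a be a column of F, let S = d_{a,b}(P) be the value-smallest longest decreasing sequence in P|_{a,b}, and let P* = P(a←S) be the left shift of S to column a. Then ins(P) = ins(P*). -/

import Mathlib

open scoped Classical

/-- A cell (square) of the grid: `(column, row)`, both `≥ 1` for genuine cells. -/
abbrev Cell : Type := ℕ × ℕ

/-- The rectangle `R(a,b)` consisting of all cells `(i,j)` with `1 ≤ i ≤ a`, `1 ≤ j ≤ b`. -/
def Rect (a b : ℕ) : Finset Cell := Finset.Icc 1 a ×ˢ Finset.Icc 1 b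

/-- A Ferrers board (French notation): a down-left closed finite set of cells with
positive coordinates. -/
def IsFerrers (F : Finset Cell) : Prop :=
  ∀ p ∈ F, 1 ≤ p.1 ∧ 1 ≤ p.2 ∧
    ∀ q : Cell, 1 ≤ q.1 → 1 ≤ q.2 → q.1 ≤ p.1 → q.2 ≤ p.2 → q ∈ F

/-- A rook placement on a board `F`: a subset of `F` with at most one cell in each
column and at most one cell in each row. -/
def IsPlacement (F P : Finset Cell) : Prop :=
  P ⊆ F ∧ (∀ p ∈ P, ∀ q ∈ P, p.1 = q.1 → p = q) ∧
    (∀ p ∈ P, ∀ q ∈ P, p.2 = q.2 → p = q)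

/-- A decreasing sequence in `P`: columns strictly increase, rows strictly decrease. -/
def IsDecSeq (P : Finset Cell) (k : ℕ) (S : Fin k → Cell) : Prop :=
  (∀ i, S i ∈ P) ∧ ∀ i j : Fin k, i < j → (S i).1 < (S j).1 ∧ (S j).2 < (S i).2

/-- An increasing sequence in `P`: columns and rows both strictly increase. -/
def IsIncSeq (P : Finset Cell) (k : ℕ) (S : Fin k → Cell) : Prop :=
  (∀ i, S i ∈ P) ∧ ∀ i j : Fin k, i < j → (S i).1 < (S j).1 ∧ (S i).2 < (S j).2

/-- Lexicographic comparison of two sequences of cells by their rows (values),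
entry by entry from the left. -/
def rowLexLE (k : ℕ) (S T : Fin k → Cell) : Prop :=
  (∀ i, (S i).2 = (T i).2) ∨
    ∃ i : Fin k, (S i).2 < (T i).2 ∧ ∀ j : Fin k, j < i → (S j).2 = (T j).2

/-- Robinson–Schensted row insertion of a value `v` into one row: returns the new row
and the bumped value (`none` if `v` was appended at the right end). The leftmost entry
strictly larger than `v` is bumped. -/
def rowInsert (v : ℕ) : List ℕ → List ℕ × Option ℕ
  | [] => ([v], none)
  | x :: xs =>
    if v < x then (v :: xs, some x)
    else
      let p := rowInsert v xs
      (x :: p.1, p.2)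

/-- Robinson–Schensted insertion of a value into a tableau (a list of rows, top row
first), bumping cascading down the rows. -/
def tabInsert (v : ℕ) : List (List ℕ) → List (List ℕ)
  | [] => [[v]]
  | row :: rest =>
    match rowInsert v row with
    | (r, none) => r :: rest
    | (r, some b) => r :: tabInsert b rest

/-- The row of the (unique) cell of `P` in column `c`. -/
noncomputable def rowAt (P : Finset Cell) (c : ℕ) : ℕ := sSup {r | (c, r) ∈ P}

/-- The cells of the placement `P`, as (column, row) pairs listed in increasing order
of column: the two-line notation of the corresponding partial permutation. -/
noncomputable def rsSteps (P : Finset Cell) : List (ℕ × ℕ) :=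
  ((P.image Prod.fst).sort (· ≤ ·)).map fun c => (c, rowAt P c)

/-- The index of the (first) row where two tableaux have different lengths. -/
noncomputable def diffRow (T T' : List (List ℕ)) : ℕ :=
  sInf {r | (T.getD r []).length ≠ (T'.getD r []).length}

/-- Append the value `v` at the right end of row `r` of a tableau (creating a new
bottom row when `r` is one past the last row). -/
def placeAt (v : ℕ) : ℕ → List (List ℕ) → List (List ℕ)
  | 0, [] => [[v]]
  | 0, row :: rest => (row ++ [v]) :: rest
  | _ + 1, [] => [[v]]
  | r + 1, row :: rest => row :: placeAt v r rest

/-- The Robinson–Schensted insertion and recording tableaux of the partial permutation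
determined by `P`, columns processed in increasing order. -/
noncomputable def rsPair (P : Finset Cell) : List (List ℕ) × List (List ℕ) :=
  (rsSteps P).foldl
    (fun TR cv =>
      let T' := tabInsert cv.2 TR.1
      (T', placeAt cv.1 (diffRow TR.1 T') TR.2))
    ([], [])

/-- The Robinson–Schensted insertion tableau `ins(P)`. -/
noncomputable def insTab (P : Finset Cell) : List (List ℕ) := (rsPair P).1

/-- The Robinson–Schensted recording tableau `rec(P)`. -/
noncomputable def recTab (P : Finset Cell) : List (List ℕ) := (rsPair P).2

/-- The restriction `P|_{a,b}` of a placement to columns `a` through `b`. -/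
def colRestrict (a b : ℕ) (P : Finset Cell) : Finset Cell :=
  P.filter fun p => a ≤ p.1 ∧ p.1 ≤ b

/-- The sequence obtained from `S = S₁…S_k` by the left shift towards column `a`:
`S_i` moves to the column of `S_{i-1}` for `i > 1`, and `S₁` moves to column `a`;
rows are unchanged. -/
def shiftLSeq (a : ℕ) (k : ℕ) (S : Fin k → Cell) : Fin k → Cell := fun i =>
  (if 0 < i.1 then (S ⟨i.1 - 1, Nat.lt_of_le_of_lt (Nat.sub_le _ _) i.isLt⟩).1 else a,
    (S i).2)

/-- The sequence obtained from `S = S₁…S_k` by the right shift towards column `b`: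
`S_i` moves to the column of `S_{i+1}` for `i < k`, and `S_k` moves to column `b`;
rows are unchanged. -/
def shiftRSeq (b : ℕ) (k : ℕ) (S : Fin k → Cell) : Fin k → Cell := fun i =>
  (if h : i.1 + 1 < k then (S ⟨i.1 + 1, h⟩).1 else b, (S i).2)

/-- The left shift `P(a ← S)` of the subplacement `S` of `P` to column `a`. -/
def leftShift (a : ℕ) (k : ℕ) (S : Fin k → Cell) (P : Finset Cell) : Finset Cell :=
  (P \ Finset.image S Finset.univ) ∪ Finset.image (shiftLSeq a k S) Finset.univ

/-- The right shift `P(S → b)` of the subplacement `S` of `P` to column `b`. -/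
def rightShift (b : ℕ) (k : ℕ) (S : Fin k → Cell) (P : Finset Cell) : Finset Cell :=
  (P \ Finset.image S Finset.univ) ∪ Finset.image (shiftRSeq b k S) Finset.univ

/-- `S` is a longest decreasing sequence in `P|_{a,b}`. -/
def IsMaxDec (a b : ℕ) (P : Finset Cell) (k : ℕ) (S : Fin k → Cell) : Prop :=
  IsDecSeq (colRestrict a b P) k S ∧
    ∀ (l : ℕ) (T : Fin l → Cell), IsDecSeq (colRestrict a b P) l T → l ≤ k

/-- `S = d_{a,b}(P)`: the lexicographically value-smallest longest decreasing sequence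
in `P|_{a,b}`. -/
def IsSmallestDec (a b : ℕ) (P : Finset Cell) (k : ℕ) (S : Fin k → Cell) : Prop :=
  IsMaxDec a b P k S ∧
    ∀ T : Fin k → Cell, IsDecSeq (colRestrict a b P) k T → rowLexLE k S T

/-- `S = D_{a,b}(P)`: the lexicographically value-largest longest decreasing sequence
in `P|_{a,b}`. -/
def IsLargestDec (a b : ℕ) (P : Finset Cell) (k : ℕ) (S : Fin k → Cell) : Prop :=
  IsMaxDec a b P k S ∧
    ∀ T : Fin k → Cell, IsDecSeq (colRestrict a b P) k T → rowLexLE k T S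

/-- `S` is a longest increasing sequence in `P|_{a,b}`. -/
def IsMaxInc (a b : ℕ) (P : Finset Cell) (k : ℕ) (S : Fin k → Cell) : Prop :=
  IsIncSeq (colRestrict a b P) k S ∧
    ∀ (l : ℕ) (T : Fin l → Cell), IsIncSeq (colRestrict a b P) l T → l ≤ k

/-- `S = i_{a,b}(P)`: the lexicographically value-smallest longest increasing sequence
in `P|_{a,b}`. -/
def IsSmallestInc (a b : ℕ) (P : Finset Cell) (k : ℕ) (S : Fin k → Cell) : Prop :=
  IsMaxInc a b P k S ∧
    ∀ T : Fin k → Cell, IsIncSeq (colRestrict a b P) k T → rowLexLE k S T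

/-- `S = I_{a,b}(P)`: the lexicographically value-largest longest increasing sequence
in `P|_{a,b}`. -/
def IsLargestInc (a b : ℕ) (P : Finset Cell) (k : ℕ) (S : Fin k → Cell) : Prop :=
  IsMaxInc a b P k S ∧
    ∀ T : Fin k → Cell, IsIncSeq (colRestrict a b P) k T → rowLexLE k T S

section RowInsertion

theorem rowInsert_of_forall_le {v : ℕ} {R : List ℕ} (h : ∀ x ∈ R, x ≤ v) :
    rowInsert v R = (R ++ [v], none) := by
  induction R with
  | nil => rfl
  | cons x xs ih =>
    have hx : ¬ v < x := not_lt.2 (h x (by simp))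
    simp [rowInsert, hx, ih fun y hy => h y (by simp [hy])]

theorem rowInsert_append_cons {v b : ℕ} {A B : List ℕ} (h : ∀ x ∈ A, x ≤ v) (hb : v < b) :
    rowInsert v (A ++ b :: B) = (A ++ v :: B, some b) := by
  induction A with
  | nil => simp [rowInsert, hb]
  | cons x xs ih =>
    have hx : ¬ v < x := not_lt.2 (h x (by simp))
    simp [rowInsert, hx, ih fun y hy => h y (by simp [hy])]

theorem forall_le_or_exists_split (v : ℕ) (R : List ℕ) :
    (∀ x ∈ R, x ≤ v) ∨ ∃ A b B, R = A ++ b :: B ∧ (∀ x ∈ A, x ≤ v) ∧ v < b := by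
  induction R with
  | nil => simp
  | cons x xs ih =>
    by_cases hx : v < x
    · exact Or.inr ⟨[], x, xs, rfl, by simp, hx⟩
    · rcases ih with h | ⟨A, b, B, rfl, hA, hb⟩
      · exact Or.inl (by simpa [not_lt.1 hx] using h)
      · exact Or.inr ⟨x :: A, b, B, rfl, by simpa [not_lt.1 hx] using hA, hb⟩

theorem pairwise_rowInsert {v : ℕ} {R : List ℕ} (h : R.Pairwise (· ≤ ·)) :
    (rowInsert v R).1.Pairwise (· ≤ ·) := by
  rcases forall_le_or_exists_split v R with hR | ⟨A, b, B, rfl, hA, hb⟩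
  · rw [rowInsert_of_forall_le hR]
    simpa [List.pairwise_append, h] using hR
  · rw [rowInsert_append_cons hA hb]
    simp only [List.pairwise_append, List.pairwise_cons, List.mem_cons] at h ⊢
    grind

/-- Insertion of an optional value: nothing is inserted when there is no value. -/
def optInsert : Option ℕ → List (List ℕ) → List (List ℕ)
  | none, T => T
  | some b, T => tabInsert b T

theorem tabInsert_eq (v : ℕ) (T : List (List ℕ)) :
    tabInsert v T =
      (rowInsert v (T.headD [])).1 :: optInsert (rowInsert v (T.headD [])).2 T.tail := by
  cases T with
  | nil => rfl
  | cons R T =>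
    simp only [tabInsert, List.headD_cons, List.tail_cons]
    rcases h : rowInsert v R with ⟨r, _ | b⟩ <;> simp [optInsert]

theorem tabInsert_cons (v : ℕ) (R : List ℕ) (T : List (List ℕ)) :
    tabInsert v (R :: T) = (rowInsert v R).1 :: optInsert (rowInsert v R).2 T :=
  tabInsert_eq v (R :: T)

/-- Invariance of successive insertion into `T` under the elementary Knuth relations. -/
def KnuthInvariant (T : List (List ℕ)) : Prop :=
  (∀ x y z, x ≤ y → y < z →
    tabInsert y (tabInsert z (tabInsert x T)) = tabInsert y (tabInsert x (tabInsert z T))) ∧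
  ∀ x y z, x < y → y ≤ z →
    tabInsert z (tabInsert x (tabInsert y T)) = tabInsert x (tabInsert z (tabInsert y T))

theorem rowInsert_bump_spec {v : ℕ} {R : List ℕ} :
    v ∈ (rowInsert v R).1 ∧ (∀ x ∈ (rowInsert v R).1, x = v ∨ x ∈ R) ∧
      ∀ r, (rowInsert v R).2 = some r → v < r ∧ r ∈ R := by
  rcases forall_le_or_exists_split v R with hR | ⟨A, b, B, rfl, hA, hb⟩
  · rw [rowInsert_of_forall_le hR]; simp; tauto
  · rw [rowInsert_append_cons hA hb]; simp; grind

theorem rowInsert_bump_le {v z : ℕ} {R : List ℕ} (h : R.Pairwise (· ≤ ·)) (hz : z ∈ R)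
    (hv : v < z) : ∃ r, (rowInsert v R).2 = some r ∧ r ≤ z := by
  rcases forall_le_or_exists_split v R with hR | ⟨A, b, B, rfl, hA, hb⟩
  · have := hR z hz; omega
  · rw [rowInsert_append_cons hA hb]
    refine ⟨b, rfl, ?_⟩
    simp only [List.pairwise_append, List.pairwise_cons, List.mem_cons, List.mem_append] at h hz
    grind

theorem rowInsert_bump_mono {y z : ℕ} {R : List ℕ} (h : R.Pairwise (· ≤ ·)) (hyz : y ≤ z) :
    (rowInsert z (rowInsert y R).1).2 = none ∨ ∃ r s, (rowInsert y R).2 = some r ∧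
      (rowInsert z (rowInsert y R).1).2 = some s ∧ r ≤ s := by
  rcases forall_le_or_exists_split y R with hR | ⟨A, b, B, rfl, hA, hb⟩
  · left
    rw [rowInsert_of_forall_le hR, rowInsert_of_forall_le]
    simp; grind
  · rw [rowInsert_append_cons hA hb]
    have e : A ++ y :: B = (A ++ [y]) ++ B := by simp
    have hle : ∀ x ∈ A ++ [y], x ≤ z := by simp; grind
    simp only [e]
    rcases forall_le_or_exists_split z B with hB | ⟨A', b', B', rfl, hA', hb'⟩
    · left
      rw [rowInsert_of_forall_le]
      intro x hx
      rcases List.mem_append.1 hx with hx | hx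
      · exact hle x hx
      · exact hB x hx
    · right
      refine ⟨b, b', rfl, ?_, ?_⟩
      · rw [← List.append_assoc, rowInsert_append_cons _ hb']
        intro x hx
        rcases List.mem_append.1 hx with hx | hx
        · exact hle x hx
        · exact hA' x hx
      · simp only [List.pairwise_append, List.pairwise_cons] at h
        exact h.2.1.1 b' (by simp)

theorem rowInsert_cons_lt {v x : ℕ} {R : List ℕ} (h : v < x) :
    rowInsert v (x :: R) = (v :: R, some x) := by simp [rowInsert, h]

theorem rowInsert_cons_ge {v x : ℕ} {R : List ℕ} (h : x ≤ v) :
    rowInsert v (x :: R) = (x :: (rowInsert v R).1, (rowInsert v R).2) := by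
  simp [rowInsert, not_lt.2 h]

theorem knuth_row_first {T : List (List ℕ)} (hT : KnuthInvariant T) {R : List ℕ}
    (hR : R.Pairwise (· ≤ ·)) {x y z : ℕ} (hxy : x ≤ y) (hyz : y < z) :
    tabInsert y (tabInsert z (tabInsert x (R :: T))) =
      tabInsert y (tabInsert x (tabInsert z (R :: T))) := by
  simp only [tabInsert_cons]
  induction R with
  | nil =>
    simp [rowInsert, not_lt.2 hxy, hyz, show ¬ z < x by omega, show x < z by omega, optInsert]
  | cons h R ih =>
    have hR' := List.pairwise_cons.1 hR
    rcases le_or_gt h x with hx | hx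
    · have := ih hR'.2
      simp only [rowInsert_cons_ge hx, rowInsert_cons_ge (show h ≤ y by omega),
        rowInsert_cons_ge (show h ≤ z by omega)]
      simp only [List.cons.injEq] at this ⊢
      exact ⟨⟨trivial, this.1⟩, this.2⟩
    · rw [rowInsert_cons_lt hx]
      dsimp only
      rw [rowInsert_cons_ge (show x ≤ z by omega)]
      dsimp only
      rw [rowInsert_cons_ge hxy]
      dsimp only
      rcases lt_or_ge z h with hz | hz
      · rw [rowInsert_cons_lt hz]
        dsimp only
        rw [rowInsert_cons_lt (show x < z by omega)]
        dsimp only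
        rw [rowInsert_cons_ge hxy]
        cases R with
        | nil => simp [rowInsert, hyz, optInsert]
        | cons r R =>
          have hr := hR'.1 r (by simp)
          simp only [rowInsert_cons_lt (show z < r by omega), rowInsert_cons_lt hyz,
            rowInsert_cons_lt (show y < r by omega), optInsert]
          rw [hT.2 z h r hz hr]
      · rw [rowInsert_cons_ge hz]
        dsimp only
        rw [rowInsert_cons_lt hx]
        dsimp only
        rw [rowInsert_cons_ge hxy]
        dsimp only
        obtain ⟨h1, h2, h3⟩ := @rowInsert_bump_spec z R
        obtain ⟨r', hr', hle⟩ := rowInsert_bump_le (pairwise_rowInsert hR'.2) h1 hyz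
        have hhr : h ≤ r' := by
          rcases h2 r' ((rowInsert_bump_spec).2.2 r' hr').2 with e | e
          · omega
          · exact hR'.1 r' e
        rw [hr']
        congr 1
        rcases ho : (rowInsert z R).2 with _ | r
        · rfl
        · exact hT.1 h r' r hhr (lt_of_le_of_lt hle (h3 r ho).1)

theorem knuth_row_second {T : List (List ℕ)} (hT : KnuthInvariant T) {R : List ℕ}
    (hR : R.Pairwise (· ≤ ·)) {x y z : ℕ} (hxy : x < y) (hyz : y ≤ z) :
    tabInsert z (tabInsert x (tabInsert y (R :: T))) =
      tabInsert x (tabInsert z (tabInsert y (R :: T))) := by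
  simp only [tabInsert_cons]
  induction R with
  | nil =>
    simp [rowInsert, not_lt.2 hyz, hxy, show ¬ z < x by omega, optInsert]
  | cons h R ih =>
    have hR' := List.pairwise_cons.1 hR
    rcases le_or_gt h x with hx | hx
    · have := ih hR'.2
      simp only [rowInsert_cons_ge hx, rowInsert_cons_ge (show h ≤ y by omega),
        rowInsert_cons_ge (show h ≤ z by omega)]
      simp only [List.cons.injEq] at this ⊢
      exact ⟨⟨trivial, this.1⟩, this.2⟩
    · rcases lt_or_ge y h with hy | hy
      · rw [rowInsert_cons_lt hy]
        dsimp only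
        rw [rowInsert_cons_lt hxy, rowInsert_cons_ge hyz]
        dsimp only
        rw [rowInsert_cons_ge (show x ≤ z by omega), rowInsert_cons_lt hxy]
        congr 1
        rcases ho : (rowInsert z R).2 with _ | r
        · rfl
        · exact hT.2 y h r hy (hR'.1 r ((rowInsert_bump_spec).2.2 r ho).2)
      · rw [rowInsert_cons_ge hy]
        dsimp only
        rw [rowInsert_cons_lt hx, rowInsert_cons_ge (show h ≤ z by omega)]
        dsimp only
        rw [rowInsert_cons_ge (show x ≤ z by omega), rowInsert_cons_lt hx]
        congr 1
        rcases rowInsert_bump_mono hR'.2 hyz with ho | ⟨r, s, h1, h2, h3⟩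
        · simp [ho, optInsert]
        · rw [h1, h2]
          have := ((rowInsert_bump_spec).2.2 r h1).1
          exact hT.2 h r s (by omega) h3

theorem knuthInvariant {T : List (List ℕ)} (h : ∀ R ∈ T, R.Pairwise (· ≤ ·)) :
    KnuthInvariant T := by
  induction T with
  | nil =>
    refine ⟨fun x y z hxy hyz => ?_, fun x y z hxy hyz => ?_⟩
    · simp [tabInsert, rowInsert, not_lt.2 hxy, hyz, show ¬ z < x by omega, show x < z by omega]
    · simp [tabInsert, rowInsert, not_lt.2 hyz, hxy, show ¬ z < x by omega]
  | cons R T ih =>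
    have hT := ih fun R' hR' => h R' (by simp [hR'])
    exact ⟨fun x y z => knuth_row_first hT (h R (by simp)),
      fun x y z => knuth_row_second hT (h R (by simp))⟩

theorem pairwise_tabInsert {T : List (List ℕ)} (h : ∀ R ∈ T, R.Pairwise (· ≤ ·)) (v : ℕ) :
    ∀ R ∈ tabInsert v T, R.Pairwise (· ≤ ·) := by
  induction T generalizing v with
  | nil => simp [tabInsert]
  | cons R T ih =>
    have hT := ih fun R' hR' => h R' (by simp [hR'])
    rw [tabInsert_cons]
    intro R' hR'
    rcases List.mem_cons.1 hR' with rfl | hR'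
    · exact pairwise_rowInsert (h R (by simp))
    · rcases ho : (rowInsert v R).2 with _ | b
      · rw [ho] at hR'; exact h R' (by simp [show R' ∈ T from hR'])
      · rw [ho] at hR'; exact hT b R' hR'

end RowInsertion

section PlacticEquivalence

/-- Two words are equivalent if inserting them into any tableau with weakly increasing rows
gives the same result. -/
def PlacticEq (w w' : List ℕ) : Prop :=
  ∀ T : List (List ℕ), (∀ R ∈ T, R.Pairwise (· ≤ ·)) →
    w.foldl (fun T v => tabInsert v T) T = w'.foldl (fun T v => tabInsert v T) T

theorem PlacticEq.refl (w : List ℕ) : PlacticEq w w := fun _ _ => rfl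

theorem PlacticEq.symm {w w' : List ℕ} (h : PlacticEq w w') : PlacticEq w' w :=
  fun T hT => (h T hT).symm

theorem PlacticEq.trans {w₁ w₂ w₃ : List ℕ} (h : PlacticEq w₁ w₂) (h' : PlacticEq w₂ w₃) :
    PlacticEq w₁ w₃ := fun T hT => (h T hT).trans (h' T hT)

theorem PlacticEq.append_right {w w' : List ℕ} (h : PlacticEq w w') (u : List ℕ) :
    PlacticEq (w ++ u) (w' ++ u) := fun T hT => by
  rw [List.foldl_append, List.foldl_append, h T hT]

theorem PlacticEq.cons {w w' : List ℕ} (h : PlacticEq w w') (v : ℕ) :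
    PlacticEq (v :: w) (v :: w') := fun _ hT => h _ (pairwise_tabInsert hT v)

theorem PlacticEq.append_left {w w' : List ℕ} (h : PlacticEq w w') (u : List ℕ) :
    PlacticEq (u ++ w) (u ++ w') := by
  induction u with
  | nil => exact h
  | cons v u ih => exact ih.cons v

theorem placticEq_first {x y z : ℕ} (hxy : x ≤ y) (hyz : y < z) :
    PlacticEq [x, z, y] [z, x, y] := fun _ hT => (knuthInvariant hT).1 x y z hxy hyz

theorem placticEq_second {x y z : ℕ} (hxy : x < y) (hyz : y ≤ z) :
    PlacticEq [y, x, z] [y, z, x] := fun _ hT => (knuthInvariant hT).2 x y z hxy hyz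

/-- A small letter moves past a decreasing word followed by a letter still larger than it. -/
theorem placticEq_cons_reverse {x h : ℕ} {c : List ℕ} (hc : (h :: c).Pairwise (· < ·))
    (hx : x < h) : PlacticEq (x :: (c.reverse ++ [h])) (c.reverse ++ [x, h]) := by
  induction c generalizing h with
  | nil => exact PlacticEq.refl _
  | cons d c ih =>
    have hd := List.pairwise_cons.1 hc
    have hhd := hd.1 d (by simp)
    have h1 := (ih hd.2 (by omega)).append_right [h]
    have h2 := (placticEq_first hx.le hhd).append_left c.reverse
    simp only [List.reverse_cons, List.append_assoc, List.cons_append, List.nil_append]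
      at h1 h2 ⊢
    exact h1.trans h2

theorem pairwise_lt_rowInsert {v : ℕ} {R : List ℕ} (h : R.Pairwise (· < ·)) (hv : v ∉ R) :
    (rowInsert v R).1.Pairwise (· < ·) := by
  rcases forall_le_or_exists_split v R with hR | ⟨A, b, B, rfl, hA, hb⟩
  · rw [rowInsert_of_forall_le hR]
    simp only [List.pairwise_append, List.pairwise_cons]
    grind
  · rw [rowInsert_append_cons hA hb]
    simp only [List.pairwise_append, List.pairwise_cons, List.mem_cons, List.mem_append] at h hv ⊢
    grind

theorem placticEq_cons_column {x : ℕ} {c : List ℕ} (hc : c.Pairwise (· < ·)) (hx : x ∉ c) :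
    PlacticEq (x :: c.reverse) ((rowInsert x c).1.reverse ++ (rowInsert x c).2.toList) := by
  induction c with
  | nil => exact PlacticEq.refl _
  | cons h c ih =>
    have hc' := List.pairwise_cons.1 hc
    simp only [List.mem_cons, not_or] at hx
    rcases lt_or_gt_of_ne hx.1 with hlt | hgt
    · rw [rowInsert_cons_lt hlt]
      simpa using placticEq_cons_reverse hc hlt
    · rw [rowInsert_cons_ge hgt.le]
      have h1 := (ih hc'.2 hx.2).append_right [h]
      obtain ⟨s1, s2, s3⟩ := @rowInsert_bump_spec x c
      have hs := pairwise_lt_rowInsert hc'.2 hx.2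
      rcases ho : (rowInsert x c).2 with _ | r
      · simpa [ho] using h1
      · rw [ho] at h1
        have hxr := (s3 r ho).1
        rcases hR : (rowInsert x c).1 with _ | ⟨g, R⟩
        · simp [hR] at s1
        · rw [hR] at h1 s1 s2 hs
          have hgx : g ≤ x := by
            rcases List.mem_cons.1 s1 with e | e
            · exact e.ge
            · exact ((List.pairwise_cons.1 hs).1 x e).le
          have hhg : h < g := by
            rcases s2 g (by simp) with e | e
            · omega
            · exact hc'.1 g e
          have h2 := (placticEq_second hhg (show g ≤ r by omega)).append_left R.reverse
          simp only [Option.toList, List.reverse_cons, List.append_assoc, List.cons_append,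
            List.nil_append] at h1 h2 ⊢
          exact h1.trans h2.symm

/-- The word of a filling given by its list of columns, each read in reverse order. -/
def columnWord (T : List (List ℕ)) : List ℕ := (T.map List.reverse).flatten

theorem rowInsert_perm (v : ℕ) (R : List ℕ) :
    ((rowInsert v R).1 ++ (rowInsert v R).2.toList).Perm (v :: R) := by
  rcases forall_le_or_exists_split v R with hR | ⟨A, b, B, rfl, hA, hb⟩
  · rw [rowInsert_of_forall_le hR]
    simp
  · rw [rowInsert_append_cons hA hb]
    rw [List.perm_iff_count]
    intro a
    simp [List.count_cons]
    omega

theorem tabInsert_flatten_perm (v : ℕ) (T : List (List ℕ)) :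
    (tabInsert v T).flatten.Perm (v :: T.flatten) := by
  induction T generalizing v with
  | nil => simp [tabInsert]
  | cons R T ih =>
    rw [tabInsert_cons]
    have h := (rowInsert_perm v R).append_right T.flatten
    rcases ho : (rowInsert v R).2 with _ | b
    · simpa [ho, optInsert] using h
    · rw [ho] at h
      simp only [optInsert, List.flatten_cons]
      refine ((ih b).append_left _).trans ?_
      simpa using h

theorem foldr_tabInsert_flatten_perm (w : List ℕ) :
    (w.foldr tabInsert []).flatten.Perm w := by
  induction w with
  | nil => simp
  | cons v w ih => exact (tabInsert_flatten_perm v _).trans (ih.cons v)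

theorem pairwise_lt_tabInsert {T : List (List ℕ)} (h : ∀ R ∈ T, R.Pairwise (· < ·)) {v : ℕ}
    (hv : (v :: T.flatten).Nodup) : ∀ R ∈ tabInsert v T, R.Pairwise (· < ·) := by
  induction T generalizing v with
  | nil => simp [tabInsert]
  | cons R T ih =>
    have hT := @ih fun R' hR' => h R' (by simp [hR'])
    have hvR : v ∉ R := fun hm => (List.nodup_cons.1 hv).1 (by simp [hm])
    rw [tabInsert_cons]
    intro R' hR'
    rcases List.mem_cons.1 hR' with rfl | hR'
    · exact pairwise_lt_rowInsert (h R (by simp)) hvR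
    · rcases ho : (rowInsert v R).2 with _ | b
      · rw [ho] at hR'; exact h R' (by simp [show R' ∈ T from hR'])
      · rw [ho] at hR'
        have hb : b ∈ R := ((rowInsert_bump_spec).2.2 b ho).2
        refine hT ?_ R' hR'
        have hnd := (List.nodup_cons.1 hv).2
        rw [List.flatten_cons, List.nodup_append] at hnd
        exact List.nodup_cons.2 ⟨fun hm => hnd.2.2 b hb b hm rfl, hnd.2.1⟩

theorem placticEq_columnWord_tabInsert {T : List (List ℕ)}
    (h : ∀ R ∈ T, R.Pairwise (· < ·)) {v : ℕ} (hv : (v :: T.flatten).Nodup) :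
    PlacticEq (v :: columnWord T) (columnWord (tabInsert v T)) := by
  induction T generalizing v with
  | nil => exact PlacticEq.refl _
  | cons R T ih =>
    have hT := @ih fun R' hR' => h R' (by simp [hR'])
    have hvR : v ∉ R := fun hm => (List.nodup_cons.1 hv).1 (by simp [hm])
    have h1 := (placticEq_cons_column (h R (by simp)) hvR).append_right (columnWord T)
    rw [tabInsert_cons]
    rcases ho : (rowInsert v R).2 with _ | b
    · simpa [ho, optInsert, columnWord] using h1
    · have hb : b ∈ R := ((rowInsert_bump_spec).2.2 b ho).2
      have hnd := (List.nodup_cons.1 hv).2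
      rw [List.flatten_cons, List.nodup_append] at hnd
      have h2 := (hT (List.nodup_cons.2 ⟨fun hm => hnd.2.2 b hb b hm rfl, hnd.2.1⟩)).append_left
        (rowInsert v R).1.reverse
      rw [ho] at h1
      simp only [optInsert, columnWord, List.map_cons, List.flatten_cons, Option.toList,
        List.append_assoc, List.cons_append, List.nil_append] at h1 h2 ⊢
      exact h1.trans h2

theorem placticEq_columnWord {w : List ℕ} (hw : w.Nodup) :
    (∀ R ∈ w.foldr tabInsert [], R.Pairwise (· < ·)) ∧
      PlacticEq w (columnWord (w.foldr tabInsert [])) := by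
  induction w with
  | nil => exact ⟨by simp, PlacticEq.refl _⟩
  | cons v w ih =>
    obtain ⟨h1, h2⟩ := ih (List.nodup_cons.1 hw).2
    have hnd : (v :: (w.foldr tabInsert []).flatten).Nodup :=
      ((foldr_tabInsert_flatten_perm w).cons v).nodup_iff.2 hw
    exact ⟨pairwise_lt_tabInsert h1 hnd,
      (h2.cons v).trans (placticEq_columnWord_tabInsert h1 hnd)⟩

/-- Words with the same tableau under insertion from right to left are equivalent. -/
theorem placticEq_of_foldr_eq {w w' : List ℕ} (hw : w.Nodup)
    (h : w.foldr tabInsert [] = w'.foldr tabInsert []) : PlacticEq w w' := by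
  have hw' : w'.Nodup := by
    rw [← (foldr_tabInsert_flatten_perm w').nodup_iff, ← h,
      (foldr_tabInsert_flatten_perm w).nodup_iff]
    exact hw
  exact (placticEq_columnWord hw).2.trans (h ▸ (placticEq_columnWord hw').2.symm)

end PlacticEquivalence

section DelayedInsertion

theorem getElem?_rowInsert_le {v : ℕ} {R : List ℕ} {i e : ℕ} (h : R[i]? = some e) :
    ∃ e' ≤ e, (rowInsert v R).1[i]? = some e' := by
  rcases forall_le_or_exists_split v R with hR | ⟨A, b, B, rfl, hA, hb⟩
  · rw [rowInsert_of_forall_le hR]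
    exact ⟨e, le_rfl, by grind⟩
  · rw [rowInsert_append_cons hA hb]
    by_cases hi : i = A.length
    · exact ⟨v, by grind, by grind⟩
    · exact ⟨e, le_rfl, by grind⟩

theorem getElem?_rowInsert_cases {v : ℕ} {R : List ℕ} {i e : ℕ}
    (h : (rowInsert v R).1[i]? = some e) :
    R[i]? = some e ∨ e = v ∧ ∀ j < i, ∃ d, R[j]? = some d ∧ d ≤ v := by
  rcases forall_le_or_exists_split v R with hR | ⟨A, b, B, rfl, hA, hb⟩
  · rw [rowInsert_of_forall_le hR] at h
    by_cases hi : i = R.length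
    · exact Or.inr ⟨by grind, fun j hj => ⟨R[j], by grind, hR _ (List.getElem_mem _)⟩⟩
    · exact Or.inl (by grind)
  · rw [rowInsert_append_cons hA hb] at h
    by_cases hi : i = A.length
    · exact Or.inr ⟨by grind, fun j hj => ⟨A[j], by grind, hA _ (List.getElem_mem _)⟩⟩
    · exact Or.inl (by grind)

theorem getElem?_rowInsert_of_prefix_le {v : ℕ} {R : List ℕ} {i : ℕ}
    (h : ∀ j < i, ∃ d, R[j]? = some d ∧ d ≤ v) :
    ∃ e ≤ v, (rowInsert v R).1[i]? = some e := by
  rcases forall_le_or_exists_split v R with hR | ⟨A, b, B, rfl, hA, hb⟩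
  · rw [rowInsert_of_forall_le hR]
    by_cases hi : i < R.length
    · exact ⟨R[i], hR _ (List.getElem_mem _), by grind⟩
    · have hi' : i = R.length := by
        by_contra hne
        obtain ⟨d, hd, -⟩ := h R.length (by omega)
        simp at hd
      exact ⟨v, le_rfl, by grind⟩
  · rw [rowInsert_append_cons hA hb]
    have hi' : i ≤ A.length := by
      by_contra hne
      obtain ⟨d, hd, hd'⟩ := h A.length (by omega)
      simp at hd
      omega
    rcases hi'.lt_or_eq with hi | hi
    · exact ⟨A[i], hA _ (List.getElem_mem _), by grind⟩
    · exact ⟨v, le_rfl, by grind⟩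

/-- Semistandard fillings, given by their lists of rows. -/
def IsTab : List (List ℕ) → Prop
  | [] => True
  | R :: T => R.Pairwise (· ≤ ·) ∧
      (∀ p e : ℕ, (T.headD [])[p]? = some e → ∃ d, R[p]? = some d ∧ d < e) ∧ IsTab T

theorem IsTab.head {T : List (List ℕ)} (h : IsTab T) : (T.headD []).Pairwise (· ≤ ·) := by
  cases T with
  | nil => exact List.Pairwise.nil
  | cons R T => exact h.1

theorem IsTab.tail {T : List (List ℕ)} (h : IsTab T) : IsTab T.tail := by
  cases T with
  | nil => exact h
  | cons R T => exact h.2.2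

theorem IsTab.column_lt {T : List (List ℕ)} (h : IsTab T) {p e : ℕ}
    (he : (T.tail.headD [])[p]? = some e) : ∃ d, (T.headD [])[p]? = some d ∧ d < e := by
  cases T with
  | nil => simp at he
  | cons R T => exact h.2.1 p e he

theorem headD_tabInsert (v : ℕ) (T : List (List ℕ)) :
    (tabInsert v T).headD [] = (rowInsert v (T.headD [])).1 := by
  rw [tabInsert_eq]; rfl

theorem tail_tabInsert (v : ℕ) (T : List (List ℕ)) :
    (tabInsert v T).tail = optInsert (rowInsert v (T.headD [])).2 T.tail := by
  rw [tabInsert_eq]; rfl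

theorem IsTab.tabInsert {T : List (List ℕ)} (h : IsTab T) (v : ℕ) : IsTab (tabInsert v T) := by
  induction T generalizing v with
  | nil => simp [_root_.tabInsert, IsTab]
  | cons R T ih =>
    rw [tabInsert_cons]
    refine ⟨pairwise_rowInsert h.1, ?_, ?_⟩
    · intro p e he
      rcases forall_le_or_exists_split v R with hR | ⟨A, b, B, rfl, hA, hb⟩
      · rw [rowInsert_of_forall_le hR] at he ⊢
        obtain ⟨d, hd, hde⟩ := h.2.1 p e he
        exact ⟨d, by grind, hde⟩
      · rw [rowInsert_append_cons hA hb] at he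
        simp only [optInsert, headD_tabInsert] at he
        rcases getElem?_rowInsert_cases he with he | ⟨rfl, hlt⟩
        · obtain ⟨d, hd, hde⟩ := h.2.1 p e he
          obtain ⟨d', hd', hd''⟩ := getElem?_rowInsert_le (v := v) hd
          exact ⟨d', hd'', by omega⟩
        · rw [rowInsert_append_cons hA hb]
          have hp : p ≤ A.length := by
            by_contra hp
            obtain ⟨d, hd, hd'⟩ := hlt A.length (by omega)
            obtain ⟨d', hd'', hlt'⟩ := h.2.1 _ _ hd
            simp at hd''
            omega
          rcases hp.lt_or_eq with hp | hp
          · exact ⟨A[p], by grind, lt_of_le_of_lt (hA _ (by simp)) hb⟩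
          · exact ⟨v, by grind, hb⟩
    · rcases (rowInsert v R).2 with _ | b
      · exact h.2.2
      · exact ih h.2.2 b

/-- `Delayed i y T T'`: the filling `T'` results from `T` by leaving out the entry `y`, which is
in position `i` of the first row of `T`, while the entries of the lower rows of `T` whose
bumping was caused by `y` are delayed in the same way. -/
inductive Delayed : ℕ → ℕ → List (List ℕ) → List (List ℕ) → Prop
  | last {A C : List ℕ} {y : ℕ} {T T' : List (List ℕ)} (hd : T'.headD [] = A ++ C)
      (tl : T'.tail = T) : Delayed A.length y ((A ++ y :: C) :: T) T'
  | step {A C D : List ℕ} {y q : ℕ} {T T' : List (List ℕ)}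
      (hq : y < q) (hd : T'.headD [] = A ++ C ++ q :: D)
      (tl : Delayed (A.length + C.length) q T T'.tail) :
      Delayed A.length y ((A ++ y :: (C ++ D)) :: T) T'

theorem Delayed.last' {A C : List ℕ} {i y : ℕ} {T T' R : List (List ℕ)}
    (hi : i = A.length) (hR : R = (A ++ y :: C) :: T)
    (hd : T'.headD [] = A ++ C) (tl : T'.tail = T) : Delayed i y R T' := by
  subst hi hR; exact .last hd tl

theorem Delayed.step' {A C D : List ℕ} {i y q : ℕ} {T T' R : List (List ℕ)}
    (hi : i = A.length) (hR : R = (A ++ y :: (C ++ D)) :: T)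
    (hq : y < q) (hd : T'.headD [] = A ++ C ++ q :: D)
    (tl : Delayed (A.length + C.length) q T T'.tail) :
    Delayed i y R T' := by
  subst hi hR; exact .step hq hd tl

theorem delayed_tabInsert_self {T : List (List ℕ)} (hT : IsTab T) {y : ℕ}
    (hy : ∀ e, (T.headD [])[0]? = some e → y < e) : Delayed 0 y (tabInsert y T) T := by
  induction T generalizing y with
  | nil => exact .last' (A := []) (C := []) rfl rfl rfl rfl
  | cons R T ih =>
    cases R with
    | nil => exact .last' (A := []) (C := []) rfl rfl rfl rfl
    | cons q D =>
      rw [tabInsert_cons, rowInsert_cons_lt (hy q rfl)]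
      refine .step' (A := []) (C := []) (D := D) (q := q) rfl rfl (hy q rfl) rfl (ih hT.2.2 ?_)
      intro e he
      obtain ⟨d, hd, hde⟩ := hT.2.1 0 e he
      simp at hd
      omega

theorem IsTab.length_tail_le {T : List (List ℕ)} (h : IsTab T) :
    (T.tail.headD []).length ≤ (T.headD []).length := by
  by_contra hlt
  push Not at hlt
  obtain ⟨d, hd, -⟩ := h.column_lt (List.getElem?_eq_getElem hlt)
  simp at hd

theorem IsTab.exists_gt_tail {T : List (List ℕ)} (h : IsTab T) {p a : ℕ}
    (ha : (T.headD [])[p]? = some a) (hp : p < (T.tail.headD []).length) :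
    ∃ e, (T.tail.headD [])[p]? = some e ∧ a < e := by
  obtain ⟨d, hd, hde⟩ := h.column_lt (List.getElem?_eq_getElem hp)
  rw [ha] at hd
  exact ⟨_, List.getElem?_eq_getElem hp, by simp at hd; omega⟩

theorem Delayed.lt_length {i y : ℕ} {T T' : List (List ℕ)} (h : Delayed i y T T') :
    i < (T.headD []).length := by
  cases h <;> simp

theorem Delayed.getElem?_eq_of_lt {i y p : ℕ} {T T' : List (List ℕ)} (h : Delayed i y T T')
    (hp : p < i) : (T.headD [])[p]? = (T'.headD [])[p]? := by
  cases h with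
  | last hd tl => rw [hd]; simp [List.getElem?_append_left hp]
  | step hq hd tl => rw [hd]; simp [List.getElem?_append_left hp]

theorem Delayed.last_of_rows {A C R : List ℕ} {i y x x' : ℕ} {o o' : Option ℕ}
    {T T' : List (List ℕ)} (e : rowInsert x R = (A ++ y :: C, o))
    (e' : rowInsert x' (T'.headD []) = (A ++ C, o')) (hi : i = A.length)
    (tl : optInsert o' T'.tail = optInsert o T) :
    Delayed i y (tabInsert x (R :: T)) (tabInsert x' T') := by
  rw [tabInsert_cons, e]
  refine .last' hi rfl ?_ ?_
  · rw [headD_tabInsert, e']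
  · rw [tail_tabInsert, e', tl]

theorem Delayed.step_of_rows {A C D R : List ℕ} {i y q x x' : ℕ} {o o' : Option ℕ}
    {T T' : List (List ℕ)} (e : rowInsert x R = (A ++ y :: (C ++ D), o))
    (e' : rowInsert x' (T'.headD []) = (A ++ C ++ q :: D, o')) (hi : i = A.length) (hq : y < q)
    (tl : Delayed (A.length + C.length) q (optInsert o T) (optInsert o' T'.tail)) :
    Delayed i y (tabInsert x (R :: T)) (tabInsert x' T') := by
  rw [tabInsert_cons, e]
  refine .step' hi rfl hq ?_ ?_
  · rw [headD_tabInsert, e']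
  · rw [tail_tabInsert, e']
    exact tl

theorem Delayed.tabInsert_eq_of_length_le {i y : ℕ} {T T' : List (List ℕ)}
    (h : Delayed i y T T') (hT : IsTab T) (hT' : IsTab T')
    (hl : (T.headD []).length ≤ i + 1) : tabInsert y T' = T := by
  induction h with
  | @last A C y T T' hd tl =>
    have hC : C = [] := by
      simp only [List.headD_cons, List.length_append, List.length_cons] at hl
      exact List.eq_nil_of_length_eq_zero (by omega)
    subst hC
    have hA := List.pairwise_append.1 hT.1
    rw [tabInsert_eq, hd, tl, rowInsert_of_forall_le (by simpa using hA.2.2)]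
    simp [optInsert]
  | @step A C D y q T T' hq hd tl ih =>
    have hC : C = [] ∧ D = [] := by
      simp only [List.headD_cons, List.length_append, List.length_cons] at hl
      exact ⟨List.eq_nil_of_length_eq_zero (by omega), List.eq_nil_of_length_eq_zero (by omega)⟩
    obtain ⟨rfl, rfl⟩ := hC
    have hA := List.pairwise_append.1 hT.1
    have hlen := hT.length_tail_le
    simp only [List.tail_cons] at hlen
    rw [tabInsert_eq, hd, List.append_nil, rowInsert_append_cons (by simpa using hA.2.2) hq]
    simp only [optInsert, List.append_nil]
    rw [ih hT.2.2 hT'.tail (by simpa using hlen.trans hl)]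

theorem Delayed.insert_pair {i y : ℕ} {T T' : List (List ℕ)} (h : Delayed i y T T')
    (hT : IsTab T) (hT' : IsTab T') :
    (∀ x, (y ≤ x ∨ ∃ p < i, ∃ e, (T.headD [])[p]? = some e ∧ x < e) →
      Delayed i y (tabInsert x T) (tabInsert x T')) ∧
    (∀ z, y ≤ z → (∀ e, (T.headD [])[i + 1]? = some e → z < e) →
      Delayed (i + 1) z (tabInsert z T) (tabInsert y T')) := by
  induction h with
  | @last A C y T T' hd tl =>
    have hs := hT.1
    simp only [List.pairwise_append, List.pairwise_cons, List.mem_cons] at hs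
    refine ⟨fun x hx => ?_, fun z hz hze => ?_⟩
    · rcases forall_le_or_exists_split x A with hA | ⟨A₁, a, A₂, rfl, hA, ha⟩
      · have hyx : y ≤ x := by
          rcases hx with hx | ⟨p, hp, e, he, hlt⟩
          · exact hx
          · simp only [List.headD_cons, List.getElem?_append_left hp] at he
            have := hA e (List.mem_of_getElem? he)
            omega
        rcases forall_le_or_exists_split x C with hC | ⟨C₁, c, C₂, rfl, hC, hc⟩
        · refine .last_of_rows (A := A) (C := C ++ [x]) (o := none) (o' := none) ?_ ?_ rfl tl
          · rw [rowInsert_of_forall_le (by simp; grind)]; simp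
          · rw [hd, rowInsert_of_forall_le (by simp; grind)]; simp
        · refine .last_of_rows (A := A) (C := C₁ ++ x :: C₂) (o := some c) (o' := some c)
            ?_ ?_ rfl (by rw [tl])
          · simpa using rowInsert_append_cons (A := A ++ y :: C₁) (B := C₂)
              (by simp; grind) hc
          · rw [hd]
            simpa using rowInsert_append_cons (A := A ++ C₁) (B := C₂) (by simp; grind) hc
      · refine .last_of_rows (A := A₁ ++ x :: A₂) (C := C) (o := some a) (o' := some a)
            ?_ ?_ (by simp) (by rw [tl])
        · simpa using rowInsert_append_cons (B := A₂ ++ y :: C) hA ha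
        · rw [hd]
          simpa using rowInsert_append_cons (B := A₂ ++ C) hA ha
    · have hAy : ∀ a ∈ A, a ≤ y := fun a ha => hs.2.2 a ha y (Or.inl rfl)
      have hAz : ∀ a ∈ A ++ [y], a ≤ z := by
        simp only [List.mem_append, List.mem_singleton]
        rintro a (ha | rfl)
        exacts [(hAy a ha).trans hz, hz]
      cases C with
      | nil =>
        refine .last_of_rows (A := A ++ [y]) (C := []) (o := none) (o' := none) ?_ ?_
          (by simp) tl
        · simpa using rowInsert_of_forall_le hAz
        · rw [hd, rowInsert_of_forall_le (by simpa using hAy)]; simp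
      | cons c C =>
        have hzc : z < c := hze c (by simp)
        refine .last_of_rows (A := A ++ [y]) (C := C) (o := some c) (o' := some c) ?_ ?_
          (by simp) (by rw [tl])
        · simpa using rowInsert_append_cons (A := A ++ [y]) (B := C) hAz hzc
        · rw [hd]
          simpa using rowInsert_append_cons (A := A) (B := C) hAy (by omega : y < c)
  | @step A C D y q T T' hq hd tl ih =>
    have hs := hT.1
    have hs' := hT'.head
    have htail := ih hT.2.2 hT'.tail
    have hlen := tl.lt_length
    rw [hd] at hs'
    simp only [List.pairwise_append, List.pairwise_cons, List.mem_cons, List.mem_append] at hs hs'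
    have hbump : ∀ p a, p < A.length + C.length → (A ++ C)[p]? = some a →
        ∃ p' < A.length + C.length, ∃ e, (T.headD [])[p']? = some e ∧ a < e := by
      intro p a hp ha
      have hp' : (T'.headD [])[p]? = some a := by
        rw [hd, List.getElem?_append_left (by simpa using hp), ha]
      obtain ⟨e, he, hae⟩ := hT'.exists_gt_tail hp' (by
        have := tl.getElem?_eq_of_lt hp
        rw [List.getElem?_eq_getElem (by omega)] at this
        exact (List.getElem?_eq_some_iff.1 this.symm).1)
      exact ⟨p, hp, e, by rw [tl.getElem?_eq_of_lt hp, he], hae⟩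
    have hnext : ∀ d D', D = d :: D' →
        ∀ e, (T.headD [])[A.length + C.length + 1]? = some e → d < e := by
      rintro d D' rfl e he
      obtain ⟨f, hf, hfe⟩ := hT.2.1 _ e he
      have : (A ++ y :: (C ++ d :: D'))[A.length + C.length + 1]? = some d := by
        simp [add_assoc]
      rw [this] at hf
      simp at hf
      omega
    refine ⟨fun x hx => ?_, fun z hz hze => ?_⟩
    · rcases forall_le_or_exists_split x A with hA | ⟨A₁, a, A₂, rfl, hA, ha⟩
      · have hyx : y ≤ x := by
          rcases hx with hx | ⟨p, hp, e, he, hlt⟩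
          · exact hx
          · simp only [List.headD_cons, List.getElem?_append_left hp] at he
            have := hA e (List.mem_of_getElem? he)
            omega
        rcases forall_le_or_exists_split x C with hC | ⟨C₁, c, C₂, rfl, hC, hc⟩
        · rcases lt_or_ge x q with hxq | hxq
          · cases D with
            | nil =>
              refine .last_of_rows (A := A) (C := C ++ [x]) (o := none) (o' := some q)
                ?_ ?_ rfl ?_
              · rw [rowInsert_of_forall_le (by simp; grind)]; simp
              · rw [hd]
                simpa using rowInsert_append_cons (A := A ++ C) (B := []) (by simp; grind) hxq
              · refine tl.tabInsert_eq_of_length_le hT.2.2 hT'.tail ?_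
                have := hT.length_tail_le
                simp at this
                simp
                omega
            | cons d D =>
              have hqd : q ≤ d := by grind
              refine .step_of_rows (A := A) (C := C ++ [x]) (D := D) (q := d) (o := some d)
                (o' := some q) ?_ ?_ rfl (by omega) ?_
              · simpa using rowInsert_append_cons (A := A ++ y :: C) (B := D)
                  (by simp; grind) (by omega : x < d)
              · rw [hd]
                simpa using rowInsert_append_cons (A := A ++ C) (B := d :: D)
                  (by simp; grind) hxq
              · have := htail.2 d hqd (hnext d D rfl)
                simpa [add_assoc, optInsert] using this
          · rcases forall_le_or_exists_split x D with hD | ⟨D₁, d, D₂, rfl, hD, hdx⟩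
            · refine .step_of_rows (A := A) (C := C) (D := D ++ [x]) (q := q) (o := none)
                (o' := none) ?_ ?_ rfl hq tl
              · rw [rowInsert_of_forall_le (by simp; grind)]; simp
              · rw [hd, rowInsert_of_forall_le (by simp; grind)]; simp
            · refine .step_of_rows (A := A) (C := C) (D := D₁ ++ x :: D₂) (q := q)
                (o := some d) (o' := some d) ?_ ?_ rfl hq (htail.1 d (Or.inl (by omega)))
              · simpa using rowInsert_append_cons (A := A ++ y :: (C ++ D₁)) (B := D₂)
                  (by simp; grind) hdx
              · rw [hd]
                simpa using rowInsert_append_cons (A := A ++ (C ++ q :: D₁)) (B := D₂)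
                  (by simp; grind) hdx
        · refine .step_of_rows (A := A) (C := C₁ ++ x :: C₂) (D := D) (q := q) (o := some c)
            (o' := some c) ?_ ?_ rfl hq ?_
          · simpa using rowInsert_append_cons (A := A ++ y :: C₁) (B := C₂ ++ D)
              (by simp; grind) hc
          · rw [hd]
            simpa using rowInsert_append_cons (A := A ++ C₁) (B := C₂ ++ q :: D)
              (by simp; grind) hc
          · have := htail.1 c (Or.inr (hbump (A.length + C₁.length) c (by simp) (by simp)))
            simpa [optInsert] using this
      · refine .step_of_rows (A := A₁ ++ x :: A₂) (C := C) (D := D) (q := q) (o := some a)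
            (o' := some a) ?_ ?_ (by simp) hq ?_
        · simpa using rowInsert_append_cons (B := A₂ ++ y :: (C ++ D)) hA ha
        · rw [hd]
          simpa using rowInsert_append_cons (B := A₂ ++ (C ++ q :: D)) hA ha
        · have := htail.1 a (Or.inr (hbump A₁.length a (by simp; omega) (by simp)))
          simpa [optInsert] using this
    · have hAy : ∀ a ∈ A, a ≤ y := fun a ha => hs.2.2 a ha y (Or.inl rfl)
      have hAz : ∀ a ∈ A ++ [y], a ≤ z := by
        simp only [List.mem_append, List.mem_singleton]
        rintro a (ha | rfl)
        exacts [(hAy a ha).trans hz, hz]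
      have hCq : ∀ c ∈ C, c ≤ q := fun c hc => hs'.2.2 c (Or.inr hc) q (Or.inl rfl)
      have hqD : ∀ d ∈ D, q ≤ d := hs'.2.1.1
      cases C with
      | nil =>
        cases D with
        | nil =>
          refine .last_of_rows (A := A ++ [y]) (C := []) (o := none) (o' := some q) ?_ ?_
            (by simp) ?_
          · simpa using rowInsert_of_forall_le hAz
          · rw [hd]
            simpa using rowInsert_append_cons (A := A) (B := []) hAy hq
          · refine tl.tabInsert_eq_of_length_le hT.2.2 hT'.tail ?_
            have := hT.length_tail_le
            simp at this
            simp
            omega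
        | cons d D =>
          have hzd : z < d := hze d (by simp)
          have hqd : q ≤ d := hqD d (by simp)
          refine .step_of_rows (A := A ++ [y]) (C := []) (D := D) (q := d) (o := some d)
            (o' := some q) ?_ ?_ (by simp) hzd ?_
          · simpa using rowInsert_append_cons (A := A ++ [y]) (B := D) hAz hzd
          · rw [hd]
            simpa using rowInsert_append_cons (A := A) (B := d :: D) hAy hq
          · have := htail.2 d hqd (hnext d D rfl)
            simpa [optInsert] using this
      | cons c C =>
        have hzc : z < c := hze c (by simp)
        have hcq : c ≤ q := hCq c (by simp)
        refine .step_of_rows (A := A ++ [y]) (C := C) (D := D) (q := q) (o := some c)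
          (o' := some c) ?_ ?_ (by simp) (by omega) ?_
        · simpa using rowInsert_append_cons (A := A ++ [y]) (B := C ++ D) hAz hzc
        · rw [hd]
          simpa using rowInsert_append_cons (A := A) (B := C ++ q :: D) hAy
            (by omega : y < c)
        · have := htail.1 c (Or.inr (hbump A.length c (by simp) (by simp)))
          simpa [add_assoc, add_comm 1, optInsert] using this

end DelayedInsertion

section DecreasingSequences

theorem IsDecSeq.mono {P Q : Finset Cell} {k : ℕ} {U : Fin k → Cell} (h : IsDecSeq P k U)
    (hPQ : P ⊆ Q) : IsDecSeq Q k U :=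
  ⟨fun i => hPQ (h.1 i), h.2⟩

theorem IsDecSeq.cons {P : Finset Cell} {k : ℕ} {U : Fin (k + 1) → Cell}
    (h : IsDecSeq P (k + 1) U) {p : Cell} (hp : p ∈ P) (h1 : p.1 < (U 0).1)
    (h2 : (U 0).2 < p.2) : IsDecSeq P (k + 2) (Fin.cons p U) := by
  refine ⟨fun i => ?_, fun i j hij => ?_⟩
  · cases i using Fin.cases with
    | zero => simpa using hp
    | succ i => simpa using h.1 i
  · cases j using Fin.cases with
    | zero => exact absurd hij (Fin.not_lt_zero i)
    | succ j =>
      cases i using Fin.cases with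
      | zero =>
        simp only [Fin.cons_zero, Fin.cons_succ]
        rcases Fin.eq_zero_or_eq_succ j with rfl | ⟨j, rfl⟩
        · exact ⟨h1, h2⟩
        · have := h.2 0 j.succ (Fin.succ_pos j)
          omega
      | succ i =>
        simpa using h.2 i j (Fin.succ_lt_succ_iff.1 hij)

theorem colRestrict_subset_of_le {a c b : ℕ} (h : a ≤ c) (P : Finset Cell) :
    colRestrict c b P ⊆ colRestrict a b P := by
  intro p hp
  simp only [colRestrict, Finset.mem_filter] at hp ⊢
  exact ⟨hp.1, h.trans hp.2.1, hp.2.2⟩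

/-- The row of a cell of `P` in column `c`, if there is one. -/
noncomputable def rowOpt (P : Finset Cell) (c : ℕ) : Option ℕ :=
  if ∃ r, (c, r) ∈ P then some (rowAt P c) else none

theorem rowOpt_congr {P Q : Finset Cell} {c : ℕ} (h : ∀ r, (c, r) ∈ P ↔ (c, r) ∈ Q) :
    rowOpt P c = rowOpt Q c := by
  simp only [rowOpt, rowAt, h]

theorem rowOpt_eq_none {P : Finset Cell} {c : ℕ} (h : ∀ r, (c, r) ∉ P) : rowOpt P c = none := by
  simp [rowOpt, h]

theorem rowOpt_eq_some {P : Finset Cell} {c v : ℕ} (h : ∀ r, (c, r) ∈ P ↔ r = v) :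
    rowOpt P c = some v := by
  simp [rowOpt, rowAt, h]

theorem rowOpt_eq_some_of_mem {P : Finset Cell} (hP : ∀ p ∈ P, ∀ q ∈ P, p.1 = q.1 → p = q)
    {p : Cell} (hp : p ∈ P) : rowOpt P p.1 = some p.2 :=
  rowOpt_eq_some fun _ => ⟨fun hr => congrArg Prod.snd (hP _ hr p hp rfl), fun hr => hr ▸ hp⟩

theorem mem_of_rowOpt_eq_some {P : Finset Cell} (hP : ∀ p ∈ P, ∀ q ∈ P, p.1 = q.1 → p = q)
    {c v : ℕ} (h : rowOpt P c = some v) : (c, v) ∈ P := by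
  by_cases hc : ∃ r, (c, r) ∈ P
  · obtain ⟨r, hr⟩ := hc
    rw [rowOpt_eq_some_of_mem hP hr] at h
    simp only [Option.some.injEq] at h
    exact h ▸ hr
  · rw [rowOpt_eq_none (by simpa using hc)] at h
    simp at h

theorem map_snd_rsSteps {P : Finset Cell} {m : ℕ} (hP : ∀ p ∈ P, p.1 ≤ m) :
    (rsSteps P).map Prod.snd = (List.range (m + 1)).filterMap (rowOpt P) := by
  have hsort : (P.image Prod.fst).sort (· ≤ ·) =
      (List.range (m + 1)).filter fun c => decide (∃ r, (c, r) ∈ P) := by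
    refine List.Perm.eq_of_pairwise (le := (· ≤ ·)) (fun _ _ _ _ => le_antisymm) ?_ ?_ ?_
    · exact Finset.pairwise_sort _ _
    · exact (List.pairwise_le_range).filter _
    · refine (List.perm_ext_iff_of_nodup (Finset.sort_nodup _ _)
        (List.nodup_range.filter _)).2 fun c => ?_
      simp only [Finset.mem_sort, Finset.mem_image, List.mem_filter, List.mem_range,
        decide_eq_true_eq, Prod.exists, exists_and_right, exists_eq_right]
      refine ⟨fun ⟨r, hr⟩ => ⟨?_, r, hr⟩, And.right⟩
      have := hP _ hr
      dsimp only at this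
      omega
  rw [rsSteps, hsort, List.map_map, ← List.filterMap_eq_map, List.filterMap_filter]
  refine List.filterMap_congr fun c _ => ?_
  simp [rowOpt]

theorem insTab_eq_foldl (P : Finset Cell) :
    insTab P = ((rsSteps P).map Prod.snd).foldl (fun T v => tabInsert v T) [] := by
  have h : ∀ (l : List (ℕ × ℕ)) (T R : List (List ℕ)),
      (l.foldl (fun TR cv =>
        let T' := tabInsert cv.2 TR.1
        (T', placeAt cv.1 (diffRow TR.1 T') TR.2)) (T, R)).1 =
      (l.map Prod.snd).foldl (fun T v => tabInsert v T) T := by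
    intro l
    induction l with
    | nil => intro T R; rfl
    | cons x l ih => intro T R; exact ih _ _
  exact h _ _ _

/-- The tableau of the entries of `f` in columns `c` to `b`, inserted from right to left. -/
def colTab (f : ℕ → Option ℕ) (b c : ℕ) : List (List ℕ) :=
  ((List.range' c (b + 1 - c)).filterMap f).foldr tabInsert []

theorem colTab_of_lt {f : ℕ → Option ℕ} {b c : ℕ} (h : b < c) : colTab f b c = [] := by
  simp [colTab, Nat.sub_eq_zero_of_le (Nat.succ_le_of_lt h)]

theorem colTab_of_le {f : ℕ → Option ℕ} {b c : ℕ} (h : c ≤ b) :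
    colTab f b c = optInsert (f c) (colTab f b (c + 1)) := by
  have : b + 1 - c = b + 1 - (c + 1) + 1 := by omega
  rw [colTab, this, List.range'_succ, List.filterMap_cons]
  cases f c <;> rfl

theorem isTab_colTab (f : ℕ → Option ℕ) (b c : ℕ) : IsTab (colTab f b c) := by
  unfold colTab
  induction (List.range' c (b + 1 - c)).filterMap f with
  | nil => trivial
  | cons v w ih => exact ih.tabInsert v

theorem exists_isDecSeq_of_getElem? {P : Finset Cell}
    (hc : ∀ p ∈ P, ∀ q ∈ P, p.1 = q.1 → p = q) (hr : ∀ p ∈ P, ∀ q ∈ P, p.2 = q.2 → p = q)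
    {b c i e : ℕ} (h : ((colTab (rowOpt P) b c).headD [])[i]? = some e) :
    ∃ U : Fin (i + 1) → Cell, IsDecSeq (colRestrict c b P) (i + 1) U ∧ (U 0).2 = e := by
  induction hn : b + 1 - c generalizing c i e with
  | zero => simp [colTab_of_lt (show b < c by omega)] at h
  | succ n ih =>
    rw [colTab_of_le (by omega)] at h
    have lift : ∀ {i e}, ((colTab (rowOpt P) b (c + 1)).headD [])[i]? = some e →
        ∃ U : Fin (i + 1) → Cell, IsDecSeq (colRestrict (c + 1) b P) (i + 1) U ∧ (U 0).2 = e :=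
      fun h => ih h (by omega)
    have hsub := colRestrict_subset_of_le (b := b) (Nat.le_add_right c 1) P
    cases hv : rowOpt P c with
    | none =>
      rw [hv] at h
      obtain ⟨U, hU, he⟩ := lift h
      exact ⟨U, hU.mono hsub, he⟩
    | some v =>
      rw [hv, optInsert, headD_tabInsert] at h
      have hcv := mem_of_rowOpt_eq_some hc hv
      have hcv' : (c, v) ∈ colRestrict c b P := by
        simp only [colRestrict, Finset.mem_filter]
        exact ⟨hcv, le_rfl, by omega⟩
      rcases getElem?_rowInsert_cases h with h | ⟨rfl, h⟩
      · obtain ⟨U, hU, he⟩ := lift h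
        exact ⟨U, hU.mono hsub, he⟩
      · cases i with
        | zero =>
          refine ⟨fun _ => (c, e), ⟨fun _ => hcv', fun i j hij => ?_⟩, rfl⟩
          omega
        | succ i =>
          obtain ⟨d, hd, hde⟩ := h i (Nat.lt_succ_self i)
          obtain ⟨U, hU, rfl⟩ := lift hd
          have h0 := hU.1 0
          simp only [colRestrict, Finset.mem_filter] at h0
          refine ⟨Fin.cons (c, e) U, (hU.mono hsub).cons hcv' (by simp; omega) ?_, rfl⟩
          refine lt_of_le_of_ne hde fun heq => ?_
          have := congrArg Prod.fst (hr _ h0.1 _ hcv heq)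
          dsimp only at this
          omega

/-- Among the cells in columns `≥ c`, no decreasing sequence that could extend `S` at its `i`-th
place starts below the `i`-th row of `S`. -/
theorem IsSmallestDec.row_le {P : Finset Cell}
    (hc : ∀ p ∈ P, ∀ q ∈ P, p.1 = q.1 → p = q) (hr : ∀ p ∈ P, ∀ q ∈ P, p.2 = q.2 → p = q)
    {a b k : ℕ} {S : Fin k → Cell} (hS : IsSmallestDec a b P k S) {c : ℕ} (hac : a ≤ c)
    {i : Fin k} (hi : ∀ j < i, (S j).1 < c) {e : ℕ}
    (he : ((colTab (rowOpt P) b c).headD [])[k - 1 - i.1]? = some e) : (S i).2 ≤ e := by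
  by_contra hlt
  push Not at hlt
  obtain ⟨U, hU, rfl⟩ := exists_isDecSeq_of_getElem? hc hr he
  have hUcol : ∀ j, c ≤ (U j).1 := fun j => by
    have := hU.1 j
    simp only [colRestrict, Finset.mem_filter] at this
    exact this.2.1
  have hU0 : ∀ j, (U j).2 ≤ (U 0).2 := fun j => by
    rcases Fin.eq_zero_or_eq_succ j with rfl | ⟨j, rfl⟩
    · exact le_rfl
    · exact (hU.2 0 j.succ (Fin.succ_pos j)).2.le
  let V : Fin k → Cell := fun j =>
    if j < i then S j else U ⟨j.1 - i.1, by omega⟩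
  have hV1 : ∀ j < i, V j = S j := fun j hj => if_pos hj
  have hV2 : ∀ j (_ : ¬ j < i), V j = U ⟨j.1 - i.1, by omega⟩ := fun j hj => if_neg hj
  have hVi : (V i).2 = (U 0).2 := by
    rw [hV2 i (lt_irrefl i)]
    simp
  have hV : IsDecSeq (colRestrict a b P) k V := by
    refine ⟨fun j => ?_, fun j l hjl => ?_⟩
    · by_cases hj : j < i
      · rw [hV1 j hj]
        exact hS.1.1.1 j
      · rw [hV2 j hj]
        exact colRestrict_subset_of_le hac P (hU.1 _)
    · by_cases hl : l < i
      · rw [hV1 l hl, hV1 j (hjl.trans hl)]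
        exact hS.1.1.2 j l hjl
      · rw [hV2 l hl]
        by_cases hj : j < i
        · rw [hV1 j hj]
          exact ⟨(hi j hj).trans_le (hUcol _),
            (hU0 _).trans_lt (hlt.trans (hS.1.1.2 j i hj).2)⟩
        · rw [hV2 j hj]
          refine hU.2 _ _ ?_
          simp only [Fin.mk_lt_mk]
          simp only [not_lt, Fin.lt_def] at *
          omega
  rcases hS.2 V hV with h | ⟨l, hl, h⟩
  · have := h i
    omega
  · rcases lt_trichotomy l i with hli | rfl | hli
    · rw [hV1 l hli] at hl
      omega
    · omega
    · have := h i hli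
      omega

theorem IsSmallestDec.row_lt {P : Finset Cell}
    (hc : ∀ p ∈ P, ∀ q ∈ P, p.1 = q.1 → p = q) (hr : ∀ p ∈ P, ∀ q ∈ P, p.2 = q.2 → p = q)
    {a b k : ℕ} {S : Fin k → Cell} (hS : IsSmallestDec a b P k S) {c : ℕ} (hac : a ≤ c)
    {i : Fin k} (hi : ∀ j ≤ i, (S j).1 < c) {e : ℕ}
    (he : ((colTab (rowOpt P) b c).headD [])[k - 1 - i.1]? = some e) : (S i).2 < e := by
  refine lt_of_le_of_ne (hS.row_le hc hr hac (fun j hj => hi j hj.le) he) fun heq => ?_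
  obtain ⟨U, hU, rfl⟩ := exists_isDecSeq_of_getElem? hc hr he
  have h0 := hU.1 0
  have h1 := hS.1.1.1 i
  simp only [colRestrict, Finset.mem_filter] at h0 h1
  have := congrArg Prod.fst (hr _ h1.1 _ h0.1 heq)
  have := hi i le_rfl
  omega

/-- Reading the columns from right to left, the tableau of the shifted word differs from that of
`P` exactly by the delayed insertion of the pending cell of `S`. -/
theorem delayed_colTab {P : Finset Cell}
    (hc : ∀ p ∈ P, ∀ q ∈ P, p.1 = q.1 → p = q) (hr : ∀ p ∈ P, ∀ q ∈ P, p.2 = q.2 → p = q)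
    {a b k : ℕ} {S : Fin k → Cell} (hS : IsSmallestDec a b P k S) {g : ℕ → Option ℕ}
    (hg : ∀ c, c ≠ a → (∀ i, (S i).1 ≠ c) → g c = rowOpt P c)
    (hgS : ∀ i (h : i + 1 < k), g (S ⟨i, by omega⟩).1 = some (S ⟨i + 1, h⟩).2)
    (hglast : ∀ i : Fin k, i.1 + 1 = k → g (S i).1 = none) {c : ℕ} (hac : a < c) :
    (∀ i, c ≤ (S i).1 → (∀ j < i, (S j).1 < c) →
      Delayed (k - 1 - i.1) (S i).2 (colTab (rowOpt P) b c) (colTab g b c)) ∧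
    ((∀ i, (S i).1 < c) → colTab (rowOpt P) b c = colTab g b c) := by
  have hmem : ∀ i, S i ∈ P ∧ a ≤ (S i).1 ∧ (S i).1 ≤ b := fun i => by
    have := hS.1.1.1 i
    simpa only [colRestrict, Finset.mem_filter] using this
  induction hn : b + 1 - c generalizing c with
  | zero =>
    refine ⟨fun i hi => ?_, fun _ => ?_⟩
    · have := (hmem i).2.2
      omega
    · rw [colTab_of_lt (by omega), colTab_of_lt (by omega)]
  | succ n ih =>
    obtain ⟨ih1, ih2⟩ := ih (c := c + 1) (by omega) (by omega)
    have hT := isTab_colTab (rowOpt P) b (c + 1)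
    have hT' := isTab_colTab g b (c + 1)
    have hPc := colTab_of_le (f := rowOpt P) (show c ≤ b by omega)
    rw [colTab_of_le (f := g) (show c ≤ b by omega)]
    by_cases hex : ∃ i₀, (S i₀).1 = c
    · obtain ⟨i₀, rfl⟩ := hex
      refine ⟨fun i hi hj => ?_, fun h => absurd (h i₀) (lt_irrefl _)⟩
      obtain rfl : i = i₀ := by
        rcases lt_trichotomy i i₀ with h | h | h
        · have := (hS.1.1.2 i i₀ h).1
          omega
        · exact h
        · exact absurd (hj i₀ h) (lt_irrefl _)
      have hle : ∀ j ≤ i, (S j).1 < (S i).1 + 1 := fun j hj' => by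
        rcases hj'.lt_or_eq with h | rfl
        · exact (hj j h).trans (Nat.lt_succ_self _)
        · exact Nat.lt_succ_self _
      have hlt : ∀ e, ((colTab (rowOpt P) b ((S i).1 + 1)).headD [])[k - 1 - i.1]? = some e →
          (S i).2 < e := fun e he => hS.row_lt hc hr (by omega) hle he
      rw [hPc, rowOpt_eq_some_of_mem hc (hmem i).1]
      by_cases hik : i.1 + 1 = k
      · have hk : k - 1 - i.1 = 0 := by omega
        rw [hglast i hik, ← ih2 fun j => hle j (by rw [Fin.le_def]; omega)]
        rw [hk] at hlt ⊢
        exact delayed_tabInsert_self hT hlt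
      · have hi1 : i.1 + 1 < k := by omega
        have hS1 := hS.1.1.2 i ⟨i.1 + 1, hi1⟩ (by simp [Fin.lt_def])
        have hk : k - 1 - i.1 = k - 1 - (i.1 + 1) + 1 := by omega
        rw [hgS i.1 hi1]
        rw [hk] at hlt ⊢
        refine ((ih1 ⟨i.1 + 1, hi1⟩ hS1.1 fun j hj' => hle j ?_).insert_pair hT hT').2
          (S i).2 hS1.2.le hlt
        rw [Fin.lt_def] at hj'
        rw [Fin.le_def]
        exact Nat.lt_succ_iff.1 hj'
    · push Not at hex
      rw [hg c hac.ne' hex]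
      refine ⟨fun i hi hj => ?_, fun h => ?_⟩
      · have hd := ih1 i (lt_of_le_of_ne hi (hex i).symm) fun j hj' =>
          (hj j hj').trans (Nat.lt_succ_self c)
        cases hv : rowOpt P c with
        | none =>
          rw [hv] at hPc
          rw [hPc]
          exact hd
        | some x =>
          rw [hv] at hPc
          rw [hPc]
          refine (hd.insert_pair hT hT').1 x ?_
          by_contra hcon
          push Not at hcon
          obtain ⟨e, hex', he⟩ := getElem?_rowInsert_of_prefix_le (v := x) (i := k - 1 - i.1)
            (R := (colTab (rowOpt P) b (c + 1)).headD []) fun p hp => by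
              have hlen := hd.lt_length
              exact ⟨_, List.getElem?_eq_getElem (by omega),
                hcon.2 p hp _ (List.getElem?_eq_getElem (by omega))⟩
          rw [← headD_tabInsert] at he
          have : (S i).2 ≤ e := hS.row_le hc hr hac.le hj (by rw [hPc]; exact he)
          omega
      · rw [hPc, ih2 fun i => (h i).trans (Nat.lt_succ_self c)]

theorem mem_leftShift {a k : ℕ} {S : Fin k → Cell} {P : Finset Cell} {p : Cell} :
    p ∈ leftShift a k S P ↔ (p ∈ P ∧ ∀ i, S i ≠ p) ∨ ∃ i, shiftLSeq a k S i = p := by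
  simp [leftShift]

end DecreasingSequences

/-- **Lemma.** Let `P` be a placement on a rectangular Ferrers board with no cell in
column `a`, let `b > a` be a column, let `S = d_{a,b}(P)` be the value-smallest longest
decreasing sequence in `P|_{a,b}`, and let `P* = P(a ← S)`. Then `ins(P) = ins(P*)`. -/
theorem ins_leftShift (m n : ℕ) (P : Finset Cell) (hP : IsPlacement (Rect m n) P)
    (a b : ℕ) (ha1 : 1 ≤ a) (hab : a < b) (hbm : b ≤ m)
    (hcol : ∀ p ∈ P, p.1 ≠ a)
    (k : ℕ) (S : Fin k → Cell) (hS : IsSmallestDec a b P k S) :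
    insTab P = insTab (leftShift a k S P) := by
  obtain ⟨hPR, hc, hr⟩ := hP
  have hmem : ∀ i, S i ∈ P ∧ a ≤ (S i).1 ∧ (S i).1 ≤ b := fun i => by
    have := hS.1.1.1 i
    simpa only [colRestrict, Finset.mem_filter] using this
  have hPm : ∀ p ∈ P, p.1 ≤ m := fun p hp => by
    have := hPR hp
    simp only [Rect, Finset.mem_product, Finset.mem_Icc] at this
    exact this.1.2
  rcases Nat.eq_zero_or_pos k with rfl | hk
  · simp [leftShift]
  have hinj : ∀ i j, (S i).1 = (S j).1 → i = j := fun i j h => by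
    rcases lt_trichotomy i j with h' | h' | h'
    · exact absurd h (hS.1.1.2 i j h').1.ne
    · exact h'
    · exact absurd h (hS.1.1.2 j i h').1.ne'
  have hScol : ∀ i, (S i).1 ≠ a := fun i => hcol _ (hmem i).1
  set Q := leftShift a k S P with hQ
  have shift_zero : shiftLSeq a k S ⟨0, hk⟩ = (a, (S ⟨0, hk⟩).2) := by simp [shiftLSeq]
  have shift_succ : ∀ i (h : i + 1 < k),
      shiftLSeq a k S ⟨i + 1, h⟩ = ((S ⟨i, by omega⟩).1, (S ⟨i + 1, h⟩).2) := fun i h => by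
    simp [shiftLSeq]
  have shift_cases : ∀ p, (∃ i, shiftLSeq a k S i = p) ↔
      p = (a, (S ⟨0, hk⟩).2) ∨
        ∃ i, ∃ h : i + 1 < k, p = ((S ⟨i, by omega⟩).1, (S ⟨i + 1, h⟩).2) := fun p => by
    constructor
    · rintro ⟨⟨_ | i, hi⟩, rfl⟩
      · exact Or.inl shift_zero
      · exact Or.inr ⟨i, hi, shift_succ i hi⟩
    · rintro (rfl | ⟨i, hi, rfl⟩)
      · exact ⟨_, shift_zero⟩
      · exact ⟨_, shift_succ i hi⟩
  have hmemQ : ∀ p, p ∈ Q ↔ (p ∈ P ∧ ∀ i, S i ≠ p) ∨ p = (a, (S ⟨0, hk⟩).2) ∨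
        ∃ i, ∃ h : i + 1 < k, p = ((S ⟨i, by omega⟩).1, (S ⟨i + 1, h⟩).2) := fun p => by
    rw [hQ, mem_leftShift, shift_cases]
  have hg : ∀ c, c ≠ a → (∀ i, (S i).1 ≠ c) → rowOpt Q c = rowOpt P c := by
    intro c hca hcS
    refine rowOpt_congr fun r => ?_
    rw [hmemQ]
    constructor
    · rintro (h | h | ⟨i, hi, h⟩)
      · exact h.1
      · exact absurd (congrArg Prod.fst h) hca
      · exact absurd (congrArg Prod.fst h).symm (hcS _)
    · exact fun h => Or.inl ⟨h, fun i hi => hcS i (congrArg Prod.fst hi)⟩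
  have hgS : ∀ i (h : i + 1 < k), rowOpt Q (S ⟨i, by omega⟩).1 = some (S ⟨i + 1, h⟩).2 := by
    intro i hi
    refine rowOpt_eq_some fun r => ?_
    rw [hmemQ]
    constructor
    · rintro (⟨h, h'⟩ | h | ⟨j, hj, h⟩)
      · exact absurd (hc _ (hmem _).1 _ h rfl) (h' _)
      · exact absurd (congrArg Prod.fst h) (hScol _)
      · have hij := congrArg Fin.val (hinj _ _ (Prod.mk.inj h).1)
        dsimp only at hij
        subst hij
        exact congrArg Prod.snd h
    · rintro rfl
      exact Or.inr (Or.inr ⟨i, hi, rfl⟩)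
  have hglast : ∀ i : Fin k, i.1 + 1 = k → rowOpt Q (S i).1 = none := by
    intro i hi
    refine rowOpt_eq_none fun r => ?_
    rw [hmemQ]
    rintro (⟨h, h'⟩ | h | ⟨j, hj, h⟩)
    · exact absurd (hc _ (hmem _).1 _ h rfl) (h' _)
    · exact absurd (congrArg Prod.fst h) (hScol _)
    · have hij := congrArg Fin.val (hinj _ _ (Prod.mk.inj h).1)
      dsimp only at hij
      omega
  have hga : rowOpt Q a = some (S ⟨0, hk⟩).2 := by
    refine rowOpt_eq_some fun r => ?_
    rw [hmemQ]
    constructor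
    · rintro (⟨h, -⟩ | h | ⟨j, hj, h⟩)
      · exact absurd rfl (hcol _ h)
      · exact congrArg Prod.snd h
      · exact absurd (congrArg Prod.fst h).symm (hScol _)
    · rintro rfl
      exact Or.inr (Or.inl rfl)
  have hPa : rowOpt P a = none := rowOpt_eq_none fun r hr' => hcol _ hr' rfl
  have hcolTab : colTab (rowOpt P) b a = colTab (rowOpt Q) b a := by
    have hd := (delayed_colTab hc hr hS hg hgS hglast (Nat.lt_add_one a)).1 ⟨0, hk⟩
      (lt_of_le_of_ne (hmem _).2.1 (hScol _).symm)
      fun j hj => absurd hj (Nat.not_lt_zero _)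
    have hPeq := colTab_of_le (f := rowOpt P) hab.le
    rw [hPa] at hPeq
    rw [colTab_of_le (f := rowOpt Q) hab.le, hga, hPeq]
    refine (hd.tabInsert_eq_of_length_le (isTab_colTab _ _ _) (isTab_colTab _ _ _) ?_).symm
    by_contra hlen
    have hlen' : k < ((colTab (rowOpt P) b (a + 1)).headD []).length := by
      dsimp only at hlen
      omega
    obtain ⟨U, hU, -⟩ := exists_isDecSeq_of_getElem? hc hr (List.getElem?_eq_getElem hlen')
    have := hS.1.2 _ U (hU.mono (colRestrict_subset_of_le (Nat.le_succ a) P))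
    omega
  have hQm : ∀ p ∈ Q, p.1 ≤ m := by
    intro p hp
    rcases (hmemQ p).1 hp with h | rfl | ⟨i, hi, rfl⟩
    · exact hPm p h.1
    · exact hab.le.trans hbm
    · exact (hmem _).2.2.trans hbm
  have hnodup : ((List.range' a (b + 1 - a)).filterMap (rowOpt P)).Nodup := by
    refine List.Nodup.filterMap ?_ (List.nodup_range' (step := 1))
    intro c c' v hcv hcv'
    exact congrArg Prod.fst (hr _ (mem_of_rowOpt_eq_some hc hcv) _
      (mem_of_rowOpt_eq_some hc hcv') rfl)
  have hout : ∀ c, c < a ∨ b < c → rowOpt P c = rowOpt Q c := fun c hcab =>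
    (hg c (by omega) fun i hi => by have := hmem i; omega).symm
  have hsplit : List.range (m + 1) =
      List.range' 0 a ++ (List.range' a (b + 1 - a) ++ List.range' (b + 1) (m - b)) := by
    have h1 := List.range'_append_1 (s := a) (m := b + 1 - a) (n := m - b)
    have h2 := List.range'_append_1 (s := 0) (m := a) (n := b + 1 - a + (m - b))
    rw [show a + (b + 1 - a) = b + 1 by omega] at h1
    rw [Nat.zero_add] at h2
    rw [h1, h2, List.range_eq_range']
    congr 1
    omega
  rw [insTab_eq_foldl, insTab_eq_foldl, map_snd_rsSteps hPm, map_snd_rsSteps hQm, hsplit]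
  simp only [List.filterMap_append]
  have hleft : (List.range' 0 a).filterMap (rowOpt P) = (List.range' 0 a).filterMap (rowOpt Q) :=
    List.filterMap_congr fun c hc' => hout c (Or.inl (by simp at hc'; omega))
  have hright : (List.range' (b + 1) (m - b)).filterMap (rowOpt P) =
      (List.range' (b + 1) (m - b)).filterMap (rowOpt Q) :=
    List.filterMap_congr fun c hc' => hout c (Or.inr (by simp at hc'; omega))
  rw [hleft, hright]
  exact ((placticEq_of_foldr_eq hnodup hcolTab).append_right _).append_left _ [] (by simp)
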